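/- arXiv:2008.10087 — 2 statements merged into one kernel-verified Lean document; each statement's English description precedes it below -/
import Mathlib

section
/- Fix μ₁ ∈ ℝ, σ > 0, π ∈ (0,1) and M ∈ ℝ. Writing p_{μ₂}(x) = π φ_{μ₁,σ}(x) + (1−π) φ_{μ₂,σ}(x) and q(x) = φ_{μ₁,σ}(x), the score of the mixture converges to the score of the left component uniformly on (−∞, M]: sup { |s_{p_{μ₂}}(x) − s_q(x)| : x ≤ M } → 0 as μ₂ → +∞. -/
open MeasureTheory Filter

/-- Gaussian density with mean `μ` and standard deviation `σ`. -/
noncomputable def gaussian (μ σ : ℝ) (x : ℝ) : ℝ :=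
  (σ * Real.sqrt (2 * Real.pi))⁻¹ * Real.exp (-(x - μ) ^ 2 / (2 * σ ^ 2))

/-- The score of a density `ρ`: the derivative of its log. -/
noncomputable def score (ρ : ℝ → ℝ) (x : ℝ) : ℝ :=
  deriv (fun y => Real.log (ρ y)) x

/-- Fisher divergence between densities `q` and `p`. -/
noncomputable def fisherDiv (q p : ℝ → ℝ) : ℝ :=
  ∫ x : ℝ, q x * (score q x - score p x) ^ 2

theorem gaussian_pos' (μ σ x : ℝ) (hσ : 0 < σ) : 0 < gaussian μ σ x := by
  unfold gaussian
  have : 0 < Real.sqrt (2 * Real.pi) := Real.sqrt_pos.2 (by positivity)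
  positivity

theorem gaussian_hasDeriv (μ σ x : ℝ) :
    HasDerivAt (gaussian μ σ) (-(x - μ) / σ ^ 2 * gaussian μ σ x) x := by
  unfold gaussian
  have h1 : HasDerivAt (fun y : ℝ => -(y - μ) ^ 2 / (2 * σ ^ 2))
      (-(2 * (x - μ)) / (2 * σ ^ 2)) x := by
    have := ((((hasDerivAt_id x).sub_const μ).pow 2).neg).div_const (2 * σ ^ 2)
    refine this.congr_deriv ?_
    simp
  have h2 := (h1.exp).const_mul ((σ * Real.sqrt (2 * Real.pi))⁻¹)
  refine h2.congr_deriv ?_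
  have : -(2 * (x - μ)) / (2 * σ ^ 2) = -(x - μ) / σ ^ 2 := by
    rw [← mul_neg, mul_div_mul_left _ _ two_ne_zero]
  rw [this]
  ring

theorem score_diff (μ₁ μ₂ σ w x : ℝ) (hσ : 0 < σ) (hw : w ∈ Set.Ioo (0 : ℝ) 1) :
    score (fun y => w * gaussian μ₁ σ y + (1 - w) * gaussian μ₂ σ y) x
      - score (fun y => gaussian μ₁ σ y) x
    = (1 - w) * gaussian μ₂ σ x / (w * gaussian μ₁ σ x + (1 - w) * gaussian μ₂ σ x)
      * ((μ₂ - μ₁) / σ ^ 2) := by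
  have g1 := gaussian_pos' μ₁ σ x hσ
  have g2 := gaussian_pos' μ₂ σ x hσ
  have hw0 := hw.1
  have hw1 : 0 < 1 - w := sub_pos.2 hw.2
  have hp : 0 < w * gaussian μ₁ σ x + (1 - w) * gaussian μ₂ σ x := by positivity
  have d1 := gaussian_hasDeriv μ₁ σ x
  have d2 := gaussian_hasDeriv μ₂ σ x
  have e1 := ((d1.const_mul w).add (d2.const_mul (1 - w))).log hp.ne'
  have e2 := d1.log g1.ne'
  have f1 : score (fun y => w * gaussian μ₁ σ y + (1 - w) * gaussian μ₂ σ y) x = _ := e1.deriv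
  have f2 : score (fun y => gaussian μ₁ σ y) x = _ := e2.deriv
  rw [f1, f2]
  simp only [Pi.add_apply]
  field_simp
  ring

theorem gaussian_ratio (μ₁ μ₂ σ x : ℝ) :
    gaussian μ₂ σ x =
      gaussian μ₁ σ x * Real.exp ((μ₂ - μ₁) * (2 * x - μ₁ - μ₂) / (2 * σ ^ 2)) := by
  unfold gaussian
  rw [mul_assoc, ← Real.exp_add]
  congr 2
  ring

/-- uniform convergence of the mixture score to the score of the left
component on `(-∞, M]`, as `μ₂ → +∞`. -/
theorem mixture_score_uniform_convergence_separation (μ₁ σ w M : ℝ) (hσ : 0 < σ)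
    (hw : w ∈ Set.Ioo (0 : ℝ) 1) :
    Tendsto
      (fun μ₂ => sSup {r : ℝ | ∃ x ≤ M,
        r = |score (fun y => w * gaussian μ₁ σ y + (1 - w) * gaussian μ₂ σ y) x
              - score (fun y => gaussian μ₁ σ y) x|})
      atTop (nhds 0) := by
  have hw0 := hw.1
  have hw1 : 0 < 1 - w := sub_pos.2 hw.2
  have hlim : Tendsto (fun μ₂ : ℝ => (1 - w) / w *
      (((μ₂ - μ₁) / σ ^ 2) ^ 1 * Real.exp (-((μ₂ - μ₁) / σ ^ 2)))) atTop (nhds 0) := by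
    have ht : Tendsto (fun μ₂ : ℝ => (μ₂ - μ₁) / σ ^ 2) atTop atTop :=
      (tendsto_atTop_add_const_right _ (-μ₁) tendsto_id).atTop_div_const (by positivity)
    simpa using ((Real.tendsto_pow_mul_exp_neg_atTop_nhds_zero 1).comp ht).const_mul ((1 - w) / w)
  refine squeeze_zero' ?_ ?_ hlim
  · refine Eventually.of_forall fun μ₂ => Real.sSup_nonneg ?_
    rintro r ⟨x, _, rfl⟩
    exact abs_nonneg _
  · filter_upwards [eventually_ge_atTop μ₁, eventually_ge_atTop (2 * M - μ₁ + 2)] with μ₂ h1 h2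
    have hd : 0 ≤ μ₂ - μ₁ := sub_nonneg.2 h1
    refine Real.sSup_le ?_ (by positivity)
    rintro r ⟨x, hx, rfl⟩
    rw [score_diff μ₁ μ₂ σ w x hσ hw]
    have g1 := gaussian_pos' μ₁ σ x hσ
    have g2 := gaussian_pos' μ₂ σ x hσ
    rw [abs_of_nonneg (by positivity)]
    have hexp : Real.exp ((μ₂ - μ₁) * (2 * x - μ₁ - μ₂) / (2 * σ ^ 2))
        ≤ Real.exp (-((μ₂ - μ₁) / σ ^ 2)) := by
      apply Real.exp_le_exp.2
      have : -((μ₂ - μ₁) / σ ^ 2) = (μ₂ - μ₁) * (-2) / (2 * σ ^ 2) := by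
        field_simp
      rw [this]
      gcongr
      linarith
    have hb : (1 - w) * gaussian μ₂ σ x / (w * gaussian μ₁ σ x + (1 - w) * gaussian μ₂ σ x)
        ≤ (1 - w) / w * Real.exp (-((μ₂ - μ₁) / σ ^ 2)) := by
      calc _ ≤ (1 - w) * gaussian μ₂ σ x / (w * gaussian μ₁ σ x) := by
            gcongr
            have : 0 < (1 - w) * gaussian μ₂ σ x := by positivity
            linarith
        _ = (1 - w) / w * Real.exp ((μ₂ - μ₁) * (2 * x - μ₁ - μ₂) / (2 * σ ^ 2)) := by
            rw [gaussian_ratio μ₁ μ₂ σ x]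
            field_simp
        _ ≤ _ := by gcongr
    calc _ ≤ (1 - w) / w * Real.exp (-((μ₂ - μ₁) / σ ^ 2)) * ((μ₂ - μ₁) / σ ^ 2) := by
          gcongr
      _ = _ := by ring
end

section
/- (Pointwise vanishing of the Fisher-divergence integrand.) Fix μ₁ ∈ ℝ, σ > 0, π ∈ (0,1) and x ∈ ℝ. Let q(x) = φ_{μ₁,σ}(x) and p_{μ₂}(x) = π φ_{μ₁,σ}(x) + (1−π) φ_{μ₂,σ}(x). Then q(x)·( s_{p_{μ₂}}(x) − s_q(x) )² → 0 as μ₂ → +∞. -/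
open MeasureTheory Filter

theorem gaussian_hasDerivAt (μ σ x : ℝ) (hσ : 0 < σ) :
    HasDerivAt (fun y => gaussian μ σ y) (gaussian μ σ x * ((μ - x) / σ ^ 2)) x := by
  unfold gaussian
  have h1 : HasDerivAt (fun y : ℝ => -(y - μ) ^ 2 / (2 * σ ^ 2))
      (-(2 * (x - μ)) / (2 * σ ^ 2)) x := by
    have h := ((((hasDerivAt_id x).sub_const μ).pow 2).neg).div_const (2 * σ ^ 2)
    exact h.congr_deriv (by simp)
  have h2 := (h1.exp).const_mul (σ * Real.sqrt (2 * Real.pi))⁻¹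
  refine h2.congr_deriv ?_
  have : -(2 * (x - μ)) / (2 * σ ^ 2) = (μ - x) / σ ^ 2 := by
    field_simp
    ring
  rw [this]
  ring

theorem gaussian_tendsto_aux (σ x : ℝ) (hσ : 0 < σ) (s : ℝ) :
    Tendsto (fun μ => |μ - x| ^ s * gaussian μ σ x) atTop (nhds 0) := by
  have ha : 0 < 1 / (2 * σ ^ 2) := by positivity
  have h := (tendsto_rpow_abs_mul_exp_neg_mul_sq_cocompact ha s).mono_left
    atTop_le_cocompact
  have h2 : Tendsto (fun μ : ℝ => μ - x) atTop atTop :=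
    tendsto_atTop_add_const_right _ (-x) tendsto_id
  have h3 := (h.comp h2).const_mul (σ * Real.sqrt (2 * Real.pi))⁻¹
  rw [mul_zero] at h3
  refine h3.congr fun μ => ?_
  simp only [Function.comp, gaussian]
  have : -(1 / (2 * σ ^ 2)) * (μ - x) ^ 2 = -(x - μ) ^ 2 / (2 * σ ^ 2) := by ring
  rw [this]
  ring

/-- pointwise vanishing of the Fisher-divergence integrand:
`q(x)·(s_{p_{μ₂}}(x) − s_q(x))² → 0` as `μ₂ → +∞`. -/
theorem fisher_integrand_pointwise_vanishing (μ₁ σ w : ℝ) (hσ : 0 < σ)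
    (hw : w ∈ Set.Ioo (0 : ℝ) 1) (x : ℝ) :
    Tendsto
      (fun μ₂ => gaussian μ₁ σ x *
        (score (fun y => w * gaussian μ₁ σ y + (1 - w) * gaussian μ₂ σ y) x
          - score (fun y => gaussian μ₁ σ y) x) ^ 2)
      atTop (nhds 0) := by
  obtain ⟨hw0, hw1⟩ := hw
  have g1 := gaussian_pos' μ₁ σ x hσ
  have hq : score (fun y => gaussian μ₁ σ y) x = (μ₁ - x) / σ ^ 2 := by
    unfold score
    rw [((gaussian_hasDerivAt μ₁ σ x hσ).log g1.ne').deriv]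
    field_simp
  have hp : ∀ μ₂, score (fun y => w * gaussian μ₁ σ y + (1 - w) * gaussian μ₂ σ y) x
      = (w * (gaussian μ₁ σ x * ((μ₁ - x) / σ ^ 2))
          + (1 - w) * (gaussian μ₂ σ x * ((μ₂ - x) / σ ^ 2)))
        / (w * gaussian μ₁ σ x + (1 - w) * gaussian μ₂ σ x) := by
    intro μ₂
    have g2 := gaussian_pos' μ₂ σ x hσ
    have hw2 : 0 < 1 - w := by linarith
    have hpos : 0 < w * gaussian μ₁ σ x + (1 - w) * gaussian μ₂ σ x := by positivity
    exact ((((gaussian_hasDerivAt μ₁ σ x hσ).const_mul w).add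
      ((gaussian_hasDerivAt μ₂ σ x hσ).const_mul (1 - w))).log hpos.ne').deriv
  have t0 : Tendsto (fun μ₂ => gaussian μ₂ σ x) atTop (nhds 0) := by
    simpa using gaussian_tendsto_aux σ x hσ 0
  have t1 : Tendsto (fun μ₂ => gaussian μ₂ σ x * ((μ₂ - x) / σ ^ 2)) atTop (nhds 0) := by
    have h := (gaussian_tendsto_aux σ x hσ 1).div_const (σ ^ 2)
    rw [zero_div] at h
    refine h.congr' ?_
    filter_upwards [eventually_ge_atTop x] with μ hμ
    rw [Real.rpow_one, abs_of_nonneg (by linarith)]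
    ring
  have hne : w * gaussian μ₁ σ x + (1 - w) * 0 ≠ 0 := by
    have : 0 < w * gaussian μ₁ σ x := by positivity
    linarith
  have t2 := ((t1.const_mul (1 - w)).const_add
    (w * (gaussian μ₁ σ x * ((μ₁ - x) / σ ^ 2)))).div
    ((t0.const_mul (1 - w)).const_add (w * gaussian μ₁ σ x)) hne
  have t3 := ((t2.sub_const ((μ₁ - x) / σ ^ 2)).pow 2).const_mul (gaussian μ₁ σ x)
  simp only [hp, hq]
  have : (w * (gaussian μ₁ σ x * ((μ₁ - x) / σ ^ 2)) + (1 - w) * 0)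
      / (w * gaussian μ₁ σ x + (1 - w) * 0) = (μ₁ - x) / σ ^ 2 := by
    simp only [mul_zero, add_zero]
    field_simp
  rw [this, sub_self, zero_pow two_ne_zero, mul_zero] at t3
  exact t3
end
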